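/- Let Λ, μ, a, m, b, r, γ be positive constants and β, η, c, θ : [0,∞) → ℝ bounded, nonnegative and continuous with c^ℓ := inf c > 0. Let (S,I,P) be a nonnegative solution, with positive initial conditions, of the ratio-dependent system S' = Λ − μS − aSP/(mP+S+I) − β(t)SI, I' = β(t)SI − η(t)PI − c(t)I, P' = (b − rP)P + γaSP/(mP+S+I) + θ(t)η(t)PI. Then limsup_{t→∞} S(t) ≤ Λ/μ, limsup_{t→∞}(S(t)+I(t)) ≤ C := Λ/min{μ, c^ℓ}, and limsup_{t→∞} P(t) ≤ D := (b + γa + θ^u η^u C)/r. In particular the region {(S,I,P) ∈ ℝ³ : 0 ≤ S+I ≤ C and 0 ≤ P ≤ D} contains the ω-limit set of every such solution. -/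

import Mathlib

open Filter MeasureTheory Set

lemma aux_ev (x x' : ℝ → ℝ) (T L δ : ℝ) (hδ : 0 < δ)
    (hx : ∀ t ≥ T, HasDerivAt x (x' t) t)
    (hd : ∀ t ≥ T, L ≤ x t → x' t ≤ -δ) : ∀ᶠ t in atTop, x t ≤ L := by
  have h1 : ∃ t₁ ≥ T, x t₁ ≤ L := by
    by_contra! hcon
    have hT := hcon T le_rfl
    have hpos : 0 ≤ 2 * (x T - L) / δ := by
      apply div_nonneg <;> linarith
    have key := image_le_of_deriv_right_lt_deriv_boundary (f := x) (f' := x')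
      (a := T) (b := T + 2 * (x T - L) / δ)
      (B := fun t => x T - δ / 2 * (t - T)) (B' := fun _ => - (δ / 2))
      (fun t ht => (hx t ht.1).continuousAt.continuousWithinAt)
      (fun t ht => (hx t ht.1).hasDerivWithinAt) (by simp)
      (fun t => by
        have := (((hasDerivAt_id t).sub_const T).const_mul (δ / 2)).const_sub (x T)
        simpa using this)
      (fun t ht _ => by
        have := hd t ht.1 (hcon t ht.1).le
        show x' t < -(δ / 2)
        linarith)
    have h2 := key (x := T + 2 * (x T - L) / δ) ⟨by linarith, le_rfl⟩
    have h3 := hcon (T + 2 * (x T - L) / δ) (by linarith)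
    have h4 : δ / 2 * (T + 2 * (x T - L) / δ - T) = x T - L := by
      field_simp
      ring
    simp only [h4] at h2
    linarith
  obtain ⟨t₁, ht₁, hxt⟩ := h1
  filter_upwards [eventually_ge_atTop t₁] with t ht
  have key := image_le_of_deriv_right_lt_deriv_boundary (f := x) (f' := x')
      (a := t₁) (b := t)
      (B := fun _ => L) (B' := fun _ => 0)
      (fun t ht => (hx t (ht₁.trans ht.1)).continuousAt.continuousWithinAt)
      (fun t ht => (hx t (ht₁.trans ht.1)).hasDerivWithinAt) hxt
      (fun t => hasDerivAt_const t L)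
      (fun t ht h => by
        have := hd t (ht₁.trans ht.1) (le_of_eq h.symm)
        show x' t < 0
        linarith)
  exact key (x := t) ⟨ht, le_rfl⟩

lemma aux_limsup (x : ℝ → ℝ) (T L : ℝ) (h0 : ∀ t ≥ T, 0 ≤ x t)
    (h : ∀ ε > 0, ∀ᶠ t in atTop, x t ≤ L + ε) : limsup x atTop ≤ L := by
  apply le_of_forall_pos_le_add
  intro ε hε
  refine limsup_le_of_le ?_ (h ε hε)
  have hb : IsBoundedUnder (· ≥ ·) atTop x :=
    ⟨0, by
      rw [eventually_map]
      filter_upwards [eventually_ge_atTop T] with t ht using h0 t ht⟩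
  exact hb.isCoboundedUnder_le

/-- STATEMENT 10: boundedness lemma for the ratio-dependent eco-epidemiological model
with `G(t,S) = Λ − μS`, `f(S,I,P) = S/(mP+S+I)`, `g(S,I,P) = P` and
`h(t,P) = b − rP`. -/
theorem stmt_10
    (Λ μ a m b r γ : ℝ)
    (hΛ : 0 < Λ) (hμ : 0 < μ) (ha : 0 < a) (hm : 0 < m) (hb : 0 < b) (hr : 0 < r)
    (hγ : 0 < γ)
    (β η c θ : ℝ → ℝ)
    (hβ : ContinuousOn β (Ici 0) ∧ (∀ t ≥ (0:ℝ), 0 ≤ β t) ∧ ∃ M, ∀ t ≥ (0:ℝ), |β t| ≤ M)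
    (hη : ContinuousOn η (Ici 0) ∧ (∀ t ≥ (0:ℝ), 0 ≤ η t) ∧ ∃ M, ∀ t ≥ (0:ℝ), |η t| ≤ M)
    (hc : ContinuousOn c (Ici 0) ∧ (∀ t ≥ (0:ℝ), 0 ≤ c t) ∧ ∃ M, ∀ t ≥ (0:ℝ), |c t| ≤ M)
    (hθ : ContinuousOn θ (Ici 0) ∧ (∀ t ≥ (0:ℝ), 0 ≤ θ t) ∧ ∃ M, ∀ t ≥ (0:ℝ), |θ t| ≤ M)
    (hcl : 0 < sInf (c '' Ici 0))
    (t₀ : ℝ) (ht₀ : 0 ≤ t₀)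
    (S I P : ℝ → ℝ)
    (hS : ∀ t ≥ t₀, HasDerivAt S
      (Λ - μ * S t - a * S t * P t / (m * P t + S t + I t) - β t * S t * I t) t)
    (hI : ∀ t ≥ t₀, HasDerivAt I
      (β t * S t * I t - η t * P t * I t - c t * I t) t)
    (hP : ∀ t ≥ t₀, HasDerivAt P
      ((b - r * P t) * P t + γ * a * S t * P t / (m * P t + S t + I t)
        + θ t * η t * P t * I t) t)
    (hnn : ∀ t ≥ t₀, 0 ≤ S t ∧ 0 ≤ I t ∧ 0 ≤ P t)
    (hinit : 0 < S t₀ ∧ 0 < I t₀ ∧ 0 < P t₀) :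
    limsup S atTop ≤ Λ / μ ∧
    limsup (fun t => S t + I t) atTop ≤ Λ / min μ (sInf (c '' Ici 0)) ∧
    limsup P atTop ≤
      (b + γ * a + sSup (θ '' Ici 0) * sSup (η '' Ici 0) *
        (Λ / min μ (sInf (c '' Ici 0)))) / r := by
  have hSI : ∀ ε > 0, ∀ᶠ t in atTop, S t + I t ≤ Λ / min μ (sInf (c '' Ici 0)) + ε := by
    intro ε hε
    set k := min μ (sInf (c '' Ici 0)) with hk
    have hkpos : 0 < k := lt_min hμ hcl
    refine aux_ev (fun t => S t + I t) _ t₀ _ (k * ε) (by positivity)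
      (fun t ht => (hS t ht).add (hI t ht)) ?_
    intro t ht hL
    obtain ⟨hs, hi, hp⟩ := hnn t ht
    have ht0 : 0 ≤ t := ht₀.trans ht
    have hct : k ≤ c t := (min_le_right _ _).trans
      (csInf_le ⟨0, by rintro _ ⟨u, hu, rfl⟩; exact hc.2.1 u hu⟩ ⟨t, ht0, rfl⟩)
    have hkm : k ≤ μ := min_le_left _ _
    have h1 : 0 ≤ a * S t * P t / (m * P t + S t + I t) := by positivity
    have h2 : 0 ≤ η t * P t * I t := by
      have := hη.2.1 t ht0
      positivity
    have h3 : k * (Λ / k + ε) ≤ k * (S t + I t) := mul_le_mul_of_nonneg_left hL hkpos.le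
    have h4 : k * (Λ / k + ε) = Λ + k * ε := by field_simp
    have h5 := mul_le_mul_of_nonneg_right hkm hs
    have h6 := mul_le_mul_of_nonneg_right hct hi
    linarith
  refine ⟨?_, ?_, ?_⟩
  · refine aux_limsup S t₀ _ (fun t ht => (hnn t ht).1) ?_
    intro ε hε
    refine aux_ev S _ t₀ _ (μ * ε) (by positivity) hS ?_
    intro t ht hL
    obtain ⟨hs, hi, hp⟩ := hnn t ht
    have ht0 : 0 ≤ t := ht₀.trans ht
    have h1 : 0 ≤ a * S t * P t / (m * P t + S t + I t) := by positivity
    have h2 : 0 ≤ β t * S t * I t := by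
      have := hβ.2.1 t ht0
      positivity
    have h3 : μ * (Λ / μ + ε) ≤ μ * S t := mul_le_mul_of_nonneg_left hL hμ.le
    have h4 : μ * (Λ / μ + ε) = Λ + μ * ε := by field_simp
    linarith
  · exact aux_limsup _ t₀ _ (fun t ht => add_nonneg (hnn t ht).1 (hnn t ht).2.1) hSI
  · refine aux_limsup P t₀ _ (fun t ht => (hnn t ht).2.2) ?_
    intro ε hε
    have hC : 0 < Λ / min μ (sInf (c '' Ici 0)) := div_pos hΛ (lt_min hμ hcl)
    set C := Λ / min μ (sInf (c '' Ici 0))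
    have hub : ∀ f : ℝ → ℝ, (∃ M, ∀ t ≥ (0:ℝ), |f t| ≤ M) →
        ∀ t ≥ (0:ℝ), f t ≤ sSup (f '' Ici 0) := by
      rintro f ⟨M, hM⟩ t ht
      exact le_csSup ⟨M, by rintro _ ⟨u, hu, rfl⟩; exact (le_abs_self _).trans (hM u hu)⟩
        ⟨t, ht, rfl⟩
    have hθu := hub θ hθ.2.2
    have hηu := hub η hη.2.2
    have hθ0 : 0 ≤ sSup (θ '' Ici 0) := (hθ.2.1 0 le_rfl).trans (hθu 0 le_rfl)
    have hη0 : 0 ≤ sSup (η '' Ici 0) := (hη.2.1 0 le_rfl).trans (hηu 0 le_rfl)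
    set q := sSup (θ '' Ici 0)
    set w := sSup (η '' Ici 0)
    have hqw : 0 ≤ q * w := mul_nonneg hθ0 hη0
    set D := (b + γ * a + q * w * C) / r with hD
    have hDpos : 0 < D := by positivity
    have hε1 : 0 < r * ε / (2 * (q * w + 1)) := by positivity
    obtain ⟨T, hT⟩ := eventually_atTop.1 (hSI _ hε1)
    set ε1 := r * ε / (2 * (q * w + 1)) with hε1d
    have hqe : q * w * ε1 ≤ r * ε / 2 := by
      have : (q * w + 1) * ε1 = r * ε / 2 := by
        rw [hε1d]; field_simp
      linarith
    refine aux_ev P _ (max t₀ T) _ ((D + ε) * (r * ε / 2)) (by positivity)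
      (fun t ht => hP t ((le_max_left _ _).trans ht)) ?_
    intro t ht hL
    have ht' : t₀ ≤ t := (le_max_left _ _).trans ht
    have ht0 : 0 ≤ t := ht₀.trans ht'
    obtain ⟨hs, hi, hp⟩ := hnn t ht'
    have hIle : I t ≤ C + ε1 := by
      have := hT t ((le_max_right _ _).trans ht)
      linarith
    have hPpos : 0 < P t := by linarith
    have h1 : γ * a * S t * P t / (m * P t + S t + I t) ≤ γ * a * P t := by
      rw [div_le_iff₀ (by positivity)]
      have e : 0 ≤ γ * a * P t * (m * P t + I t) := by positivity
      nlinarith [e]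
    have h2 : θ t * η t * I t ≤ q * w * (C + ε1) :=
      mul_le_mul (mul_le_mul (hθu t ht0) (hηu t ht0) (hη.2.1 t ht0) hθ0) hIle hi hqw
    have h3 : r * D = b + γ * a + q * w * C := by rw [hD]; field_simp
    have h4 : b - r * P t + γ * a + θ t * η t * I t ≤ -(r * ε / 2) := by
      have := mul_le_mul_of_nonneg_left hL hr.le
      linarith
    have h5 := mul_le_mul_of_nonneg_right h4 hp
    have h6 : (D + ε) * (r * ε / 2) ≤ P t * (r * ε / 2) :=
      mul_le_mul_of_nonneg_right hL (by positivity)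
    linarith
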